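/- arXiv:1601.01710 — 5 statements merged into one kernel-verified Lean document; each statement's English description precedes it below -/
import Mathlib

section
/- Let m(i,j) > 0, for i,j ∈ {−1,1}, be real numbers; set M(i) := m(i,1) + m(i,−1), Δ := m(1,1)m(−1,−1) − m(−1,1)m(1,−1), and R(X) := m(1,1)X² − (1+Δ)X + m(−1,−1). Then R(1) = (M(1)−1)(1−m(−1,−1)) + m(1,−1)(M(−1)−1). Consequently, if M(1) < 1, M(−1) < 1 (hence in particular m(−1,−1) < 1), then R(1) < 0, the discriminant (1+Δ)² − 4m(1,1)m(−1,−1) is positive, and R has exactly two real roots: λ := (1+Δ − √((1+Δ)² − 4m(1,1)m(−1,−1)))/(2m(1,1)) lies in the open interval (0,1), and the other root λ₊ := (1+Δ + √((1+Δ)² − 4m(1,1)m(−1,−1)))/(2m(1,1)) is strictly greater than 1. -/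
/-- A quadratic `aX² - sX + d` with positive outer coefficients and negative value at `1`
has positive discriminant. -/
theorem discrim_pos_of_eval_one_neg {a s d : ℝ} (ha : 0 < a) (hd : 0 < d)
    (h : a - s + d < 0) : 0 < s ^ 2 - 4 * a * d := by
  nlinarith [sq_nonneg (a - d)]

/-- A real quadratic with nonnegative discriminant factors through its roots. -/
theorem quadratic_eq_mul_sub_roots {a s d : ℝ} (ha : a ≠ 0) (h : 0 ≤ s ^ 2 - 4 * a * d)
    (x : ℝ) :
    a * x ^ 2 - s * x + d =
      a * (x - (s - √(s ^ 2 - 4 * a * d)) / (2 * a)) *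
        (x - (s + √(s ^ 2 - 4 * a * d)) / (2 * a)) := by
  have hq := Real.sq_sqrt h
  generalize √(s ^ 2 - 4 * a * d) = q at hq ⊢
  field_simp
  linear_combination hq

/-- Properties of the characteristic polynomial
`R(X) = m(1,1)X² - (1+Δ)X + m(-1,-1)` where `Δ = m(1,1)m(-1,-1) - m(-1,1)m(1,-1)`:
the identity `R(1) = (M(1)-1)(1-m(-1,-1)) + m(1,-1)(M(-1)-1)` always holds, and if the
row sums `M(1), M(-1)` are `< 1` then `R(1) < 0`, the discriminant is positive, and `R`
has exactly two real roots, the smaller one in `(0,1)` and the larger one `> 1`. -/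
theorem characteristic_polynomial_roots
    (m : ℤ → ℤ → ℝ)
    (hpos : ∀ i ∈ ({-1, 1} : Set ℤ), ∀ j ∈ ({-1, 1} : Set ℤ), 0 < m i j)
    (M : ℤ → ℝ) (hM : ∀ i : ℤ, M i = m i 1 + m i (-1))
    (Δ : ℝ) (hΔ : Δ = m 1 1 * m (-1) (-1) - m (-1) 1 * m 1 (-1))
    (R : ℝ → ℝ) (hR : ∀ X : ℝ, R X = m 1 1 * X ^ 2 - (1 + Δ) * X + m (-1) (-1)) :
    R 1 = (M 1 - 1) * (1 - m (-1) (-1)) + m 1 (-1) * (M (-1) - 1) ∧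
    (M 1 < 1 → M (-1) < 1 →
      R 1 < 0 ∧
      0 < (1 + Δ) ^ 2 - 4 * m 1 1 * m (-1) (-1) ∧
      (let lam : ℝ :=
        (1 + Δ - Real.sqrt ((1 + Δ) ^ 2 - 4 * m 1 1 * m (-1) (-1))) / (2 * m 1 1)
       let lamPlus : ℝ :=
        (1 + Δ + Real.sqrt ((1 + Δ) ^ 2 - 4 * m 1 1 * m (-1) (-1))) / (2 * m 1 1)
       R lam = 0 ∧ R lamPlus = 0 ∧ 0 < lam ∧ lam < 1 ∧ 1 < lamPlus ∧
        ∀ x : ℝ, R x = 0 → x = lam ∨ x = lamPlus)) := by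
  have ha : 0 < m 1 1 := hpos 1 (by simp) 1 (by simp)
  have hb : 0 < m 1 (-1) := hpos 1 (by simp) (-1) (by simp)
  have hc : 0 < m (-1) 1 := hpos (-1) (by simp) 1 (by simp)
  have hd : 0 < m (-1) (-1) := hpos (-1) (by simp) (-1) (by simp)
  have hR1 : R 1 = (M 1 - 1) * (1 - m (-1) (-1)) + m 1 (-1) * (M (-1) - 1) := by
    rw [hR, hM, hM, hΔ]
    ring
  refine ⟨hR1, fun h₁ h₂ => ?_⟩
  have hd1 : m (-1) (-1) < 1 := by linarith [hM (-1)]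
  have hneg : R 1 < 0 := by
    rw [hR1]
    nlinarith [mul_pos (sub_pos.2 h₁) (sub_pos.2 hd1), mul_pos hb (sub_pos.2 h₂)]
  have hneg' : m 1 1 - (1 + Δ) + m (-1) (-1) < 0 := by linarith [hR 1]
  have hdisc := discrim_pos_of_eval_one_neg ha hd hneg'
  refine ⟨hneg, hdisc, ?_⟩
  intro lam lamPlus
  have hfac (x : ℝ) : R x = m 1 1 * (x - lam) * (x - lamPlus) :=
    (hR x).trans (quadratic_eq_mul_sub_roots ha.ne' hdisc.le x)
  have hsqrt := Real.sqrt_pos.2 hdisc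
  have hlt : lam < lamPlus := div_lt_div_of_pos_right (by linarith) (by positivity)
  have hprod : (1 - lam) * (1 - lamPlus) < 0 := by
    have h := hfac 1
    by_contra! hge
    nlinarith [mul_nonneg ha.le hge]
  have hlam : lam < 1 := by
    by_contra! hge
    nlinarith [mul_nonneg (sub_nonneg.2 hge) (sub_nonneg.2 (hge.trans hlt.le))]
  have hlamPlus : 1 < lamPlus := by
    by_contra! hle
    nlinarith [mul_nonneg (sub_nonneg.2 hlam.le) (sub_nonneg.2 hle)]
  have hpos_lam : 0 < lam := by
    have h : m 1 1 * lam * lamPlus = m (-1) (-1) := by linarith [hfac 0, hR 0]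
    have h' : 0 < m 1 1 * lam * lamPlus := h ▸ hd
    exact pos_of_mul_pos_right
      (pos_of_mul_pos_left h' (zero_le_one.trans hlamPlus.le)) ha.le
  refine ⟨by simp [hfac], by simp [hfac], hpos_lam, hlam, hlamPlus, fun x hx => ?_⟩
  simpa [hfac, ha.ne', sub_eq_zero] using hx
end

section
/- Let m(i,j) > 0, for i,j ∈ {−1,1}, be real numbers with M(i) := m(i,1) + m(i,−1) < 1 for i = ±1, and let Δ := m(1,1)m(−1,−1) − m(−1,1)m(1,−1) and λ := (1+Δ − √((1+Δ)² − 4m(1,1)m(−1,−1)))/(2m(1,1)). Suppose (a_n)_{n≥0} and (b_n)_{n≥0} are real sequences with a_0 = b_0 = 1, |a_n| ≤ 1 and |b_n| ≤ 1 for all n, satisfying a_{n+1} = m(1,1) a_{n+2} + m(1,−1) b_n and b_{n+1} = m(−1,1) a_{n+2} + m(−1,−1) b_n for all n ≥ 0. Then for all n ≥ 1, a_n = a_1 λ^{n−1} and b_n = b_1 λ^{n−1}, where a_1 = m(1,−1)/(1 − λ m(1,1)) and b_1 = (m(−1,1) a_1 + Δ)/m(1,1). -/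
/-- A bounded real sequence that is geometric with ratio greater than one vanishes. -/
theorem eq_zero_of_bounded_of_geometric {w : ℕ → ℝ} {μ C : ℝ} (hμ : 1 < μ)
    (hw : ∀ n, w (n + 1) = μ * w n) (hC : ∀ n, |w n| ≤ C) (n : ℕ) : w n = 0 := by
  have hpow : ∀ n, w n = μ ^ n * w 0 := by
    intro n
    induction n with
    | zero => simp
    | succ k ih => rw [hw, ih, pow_succ]; ring
  suffices h0 : w 0 = 0 by rw [hpow, h0, mul_zero]
  by_contra h0
  have h0' : 0 < |w 0| := abs_pos.mpr h0
  obtain ⟨k, hk⟩ := pow_unbounded_of_one_lt (C / |w 0|) hμ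
  rw [div_lt_iff₀ h0'] at hk
  have hCk := hC k
  rw [hpow, abs_mul, abs_of_pos (pow_pos (zero_lt_one.trans hμ) k)] at hCk
  linarith


/-- Uniqueness of the bounded solution of the coupled recurrence system: if
`(a_n)`, `(b_n)` are real sequences with `a_0 = b_0 = 1`, bounded by `1` in absolute
value, satisfying `a_{n+1} = m(1,1)a_{n+2} + m(1,-1)b_n` and
`b_{n+1} = m(-1,1)a_{n+2} + m(-1,-1)b_n`, and the row sums `M(i) < 1`, then
`a_n = a₁ λ^{n-1}` and `b_n = b₁ λ^{n-1}` where `λ` is the smaller root of the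
characteristic polynomial, `a₁ = m(1,-1)/(1 - λ m(1,1))` and
`b₁ = (m(-1,1)a₁ + Δ)/m(1,1)`. -/
theorem bounded_solution_is_geometric
    (m : ℤ → ℤ → ℝ)
    (hpos : ∀ i ∈ ({-1, 1} : Set ℤ), ∀ j ∈ ({-1, 1} : Set ℤ), 0 < m i j)
    (hM1 : m 1 1 + m 1 (-1) < 1) (hM2 : m (-1) 1 + m (-1) (-1) < 1)
    (Δ : ℝ) (hΔ : Δ = m 1 1 * m (-1) (-1) - m (-1) 1 * m 1 (-1))
    (lam : ℝ)
    (hlam : lam =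
      (1 + Δ - Real.sqrt ((1 + Δ) ^ 2 - 4 * m 1 1 * m (-1) (-1))) / (2 * m 1 1))
    (a b : ℕ → ℝ)
    (ha0 : a 0 = 1) (hb0 : b 0 = 1)
    (habd : ∀ n : ℕ, |a n| ≤ 1) (hbbd : ∀ n : ℕ, |b n| ≤ 1)
    (ha : ∀ n : ℕ, a (n + 1) = m 1 1 * a (n + 2) + m 1 (-1) * b n)
    (hb : ∀ n : ℕ, b (n + 1) = m (-1) 1 * a (n + 2) + m (-1) (-1) * b n) :
    a 1 = m 1 (-1) / (1 - lam * m 1 1) ∧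
    b 1 = (m (-1) 1 * a 1 + Δ) / m 1 1 ∧
    ∀ n : ℕ, 1 ≤ n → a n = a 1 * lam ^ (n - 1) ∧ b n = b 1 * lam ^ (n - 1) := by
  have hp : 0 < m 1 1 := hpos 1 (by simp) 1 (by simp)
  have hq : 0 < m 1 (-1) := hpos 1 (by simp) (-1) (by simp)
  have hr : 0 < m (-1) 1 := hpos (-1) (by simp) 1 (by simp)
  have hs : 0 < m (-1) (-1) := hpos (-1) (by simp) (-1) (by simp)
  generalize m 1 1 = p at *
  generalize m 1 (-1) = q at *
  generalize m (-1) 1 = r at *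
  generalize m (-1) (-1) = s at *
  have hR1 : p + s < 1 + Δ := by
    have := mul_lt_mul'' (show q < 1 - p by linarith) (show r < 1 - s by linarith) hq.le hr.le
    rw [hΔ]; linarith
  have hD : (2 * p - (1 + Δ)) ^ 2 < (1 + Δ) ^ 2 - 4 * p * s := by
    nlinarith [mul_pos hp (sub_pos.mpr hR1)]
  have hsq := Real.sq_sqrt ((sq_nonneg _).trans hD.le)
  have hlt := Real.lt_sqrt_of_sq_lt hD
  generalize Real.sqrt ((1 + Δ) ^ 2 - 4 * p * s) = t at *
  have hpl : 2 * (p * lam) = 1 + Δ - t := by rw [hlam]; field_simp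
  have hroot : (p * lam - Δ) * (1 - p * lam) = r * q := by
    have ht : t = 1 + Δ - 2 * (p * lam) := by linarith
    rw [ht] at hsq
    linarith
  have hne : 1 - lam * p ≠ 0 := by
    intro h
    rw [mul_comm p lam, h, mul_zero] at hroot
    exact (mul_pos hr hq).ne hroot
  have hμ : 1 < (1 + Δ - p * lam) / p := by
    rw [lt_div_iff₀ hp]; linarith
  have hb' : ∀ n, p * b (n + 1) = r * a (n + 1) + Δ * b n := by
    intro n
    linear_combination p * hb n - r * ha n - b n * hΔ
  have hzero := eq_zero_of_bounded_of_geometric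
    (w := fun n => r * a (n + 1) + (Δ - p * lam) * b n) (C := r + |Δ - p * lam|) hμ
    (fun n => by
      have h1 := ha n
      have h2 := hb' n
      rw [div_mul_eq_mul_div, eq_div_iff hp.ne']
      linear_combination (Δ - p * lam) * h2 - r * h1 + b n * hroot)
    (fun n => by
      refine (abs_add_le _ _).trans (add_le_add ?_ ?_)
      · rw [abs_mul, abs_of_pos hr]
        exact mul_le_of_le_one_right hr.le (habd _)
      · rw [abs_mul]
        exact mul_le_of_le_one_right (abs_nonneg _) (hbbd _))
  have hbs : ∀ n, b (n + 1) = lam * b n := by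
    intro n
    apply mul_left_cancel₀ hp.ne'
    linear_combination hb' n + hzero n
  have hbn : ∀ n, b n = lam ^ n := by
    intro n
    induction n with
    | zero => simpa using hb0
    | succ k ih => rw [hbs, ih, pow_succ']
  have ha1 : r * a 1 = p * lam - Δ := by
    have h := hzero 0
    simp only [zero_add, hb0] at h
    linarith
  refine ⟨?_, ?_, ?_⟩
  · rw [eq_div_iff hne]
    apply mul_left_cancel₀ hr.ne'
    linear_combination (1 - lam * p) * ha1 + hroot
  · rw [eq_div_iff hp.ne']
    have h := hb' 0
    simp only [zero_add, hb0] at h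
    linarith
  · rintro (_ | n) hn
    · omega
    · have h := hzero n
      simp only [hbn n] at h
      simp only [Nat.add_sub_cancel]
      refine ⟨mul_left_cancel₀ hr.ne' ?_, ?_⟩
      · linear_combination h - lam ^ n * ha1
      · rw [hbn, hbn, pow_succ, pow_one, mul_comm]
end

section
/- Suppose P(i,j) ∈ (0,1) for i,j ∈ {−1,1} with P(i,1) + P(i,−1) = 1, and m(s,i,j), for s > 0, are real numbers with 0 < m(s,i,j), m(s,i,1) + m(s,i,−1) < 1 for each s > 0, and lim_{s→0⁺} m(s,i,j) = P(i,j) for all i,j. Define Δ(s) := m(s,1,1)m(s,−1,−1) − m(s,−1,1)m(s,1,−1) and λ(s) := (1+Δ(s) − √((1+Δ(s))² − 4m(s,1,1)m(s,−1,−1)))/(2m(s,1,1)). Then lim_{s→0⁺} λ(s) = min(1, P(−1,−1)/P(1,1)). In particular this limit equals 1 if and only if P(1,1) ≤ P(−1,−1). -/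
open Filter
open scoped Topology

/-- If `m(s,i,j) → P(i,j)` as `s → 0⁺`, where `P` is a stochastic matrix on `{-1,1}`
with entries in `(0,1)`, then the smaller root `λ(s)` of the quadratic
`m(s,1,1)X² - (1+Δ(s))X + m(s,-1,-1)` tends to `min(1, P(-1,-1)/P(1,1))`; this limit
equals `1` iff `P(1,1) ≤ P(-1,-1)`. -/
theorem smaller_root_limit
    (P : ℤ → ℤ → ℝ)
    (hmem : ∀ i ∈ ({-1, 1} : Set ℤ), ∀ j ∈ ({-1, 1} : Set ℤ), P i j ∈ Set.Ioo (0 : ℝ) 1)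
    (hrow : ∀ i ∈ ({-1, 1} : Set ℤ), P i 1 + P i (-1) = 1)
    (m : ℝ → ℤ → ℤ → ℝ)
    (hmpos : ∀ s : ℝ, 0 < s →
      ∀ i ∈ ({-1, 1} : Set ℤ), ∀ j ∈ ({-1, 1} : Set ℤ), 0 < m s i j)
    (hmrow : ∀ s : ℝ, 0 < s →
      ∀ i ∈ ({-1, 1} : Set ℤ), m s i 1 + m s i (-1) < 1)
    (hmlim : ∀ i ∈ ({-1, 1} : Set ℤ), ∀ j ∈ ({-1, 1} : Set ℤ),
      Tendsto (fun s : ℝ => m s i j) (𝓝[>] 0) (𝓝 (P i j)))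
    (Δ lam : ℝ → ℝ)
    (hΔ : ∀ s : ℝ, Δ s = m s 1 1 * m s (-1) (-1) - m s (-1) 1 * m s 1 (-1))
    (hlam : ∀ s : ℝ, lam s =
      (1 + Δ s - Real.sqrt ((1 + Δ s) ^ 2 - 4 * m s 1 1 * m s (-1) (-1))) /
        (2 * m s 1 1)) :
    Tendsto lam (𝓝[>] 0) (𝓝 (min 1 (P (-1) (-1) / P 1 1))) ∧
    (min 1 (P (-1) (-1) / P 1 1) = 1 ↔ P 1 1 ≤ P (-1) (-1)) := by
  have h₁ : (1 : ℤ) ∈ ({-1, 1} : Set ℤ) := by simp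
  have h₂ : (-1 : ℤ) ∈ ({-1, 1} : Set ℤ) := by simp
  have ha : 0 < P 1 1 := (hmem 1 h₁ 1 h₁).1
  refine ⟨?_, ?_⟩
  · have hD : Tendsto (fun s => 1 + Δ s) (𝓝[>] 0) (𝓝 (P 1 1 + P (-1) (-1))) := by
      have h := (((hmlim 1 h₁ 1 h₁).mul (hmlim (-1) h₂ (-1) h₂)).sub
        ((hmlim (-1) h₂ 1 h₁).mul (hmlim 1 h₁ (-1) h₂))).const_add 1
      simp only [hΔ]
      convert h using 2
      rw [eq_sub_of_add_eq (hrow (-1) h₂), eq_sub_of_add_eq' (hrow 1 h₁)]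
      ring
    have hS := ((hD.pow 2).sub
      (((hmlim 1 h₁ 1 h₁).const_mul 4).mul (hmlim (-1) h₂ (-1) h₂))).sqrt
    have h := (hD.sub hS).div ((hmlim 1 h₁ 1 h₁).const_mul 2) (by positivity)
    rw [funext hlam]
    convert! h using 2
    rw [show (P 1 1 + P (-1) (-1)) ^ 2 - 4 * P 1 1 * P (-1) (-1) =
      (P 1 1 - P (-1) (-1)) ^ 2 by ring, Real.sqrt_sq_eq_abs]
    rcases le_total (P 1 1) (P (-1) (-1)) with hle | hle
    · rw [min_eq_left ((one_le_div ha).2 hle), abs_of_nonpos (by linarith)]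
      field_simp
      ring
    · rw [min_eq_right ((div_le_one ha).2 hle), abs_of_nonneg (by linarith)]
      field_simp
      ring
  · rw [min_eq_left_iff, one_le_div ha]
end

section
/- Let δ > 0 and p, p' ∈ (0,1), and define π* := (1−p')/(2−p−p'), s* := δ(2π*−1), b(δ) := δ − s*, b(−δ) := −δ − s*, g(δ) := δ(p'−p+2(1−π*))/(p+p'−2) − s*, g(−δ) := δ(p'−p−2π*)/(p+p'−2) − s*, P(δ) := 1−p, P(−δ) := 1−p', and for i ∈ {δ, −δ}: v(i) := b(i)² + P(i)(g(−i) − g(i))² − 2 b(i) P(i)(g(−i) − g(i)). Then π* v(δ) + (1−π*) v(−δ) = 4δ² ( (1 − p' + π*(p' − p))/(p + p' − 2)² − π*(1−π*) ). -/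
/-- The asymptotic variance identity for the diffusion limit: with
`π* = (1-p')/(2-p-p')`, `s* = δ(2π*-1)`, centered increments `b(±δ) = ±δ - s*`,
Poisson-equation solution `g`, switching probabilities `P(δ) = 1-p`, `P(-δ) = 1-p'`,
and `v(i) = b(i)² + P(i)(g(-i)-g(i))² - 2b(i)P(i)(g(-i)-g(i))`, one has
`π* v(δ) + (1-π*) v(-δ) = 4δ²((1-p'+π*(p'-p))/(p+p'-2)² - π*(1-π*))`. -/
theorem asymptotic_variance_identity
    (δ p p' : ℝ) (hδ : 0 < δ)
    (hp : p ∈ Set.Ioo (0 : ℝ) 1) (hp' : p' ∈ Set.Ioo (0 : ℝ) 1)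
    (piStar sStar bPlus bMinus gPlus gMinus PPlus PMinus vPlus vMinus : ℝ)
    (hpi : piStar = (1 - p') / (2 - p - p'))
    (hs : sStar = δ * (2 * piStar - 1))
    (hbPlus : bPlus = δ - sStar)
    (hbMinus : bMinus = -δ - sStar)
    (hgPlus : gPlus = δ * (p' - p + 2 * (1 - piStar)) / (p + p' - 2) - sStar)
    (hgMinus : gMinus = δ * (p' - p - 2 * piStar) / (p + p' - 2) - sStar)
    (hPPlus : PPlus = 1 - p) (hPMinus : PMinus = 1 - p')
    (hvPlus : vPlus = bPlus ^ 2 + PPlus * (gMinus - gPlus) ^ 2 -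
      2 * bPlus * PPlus * (gMinus - gPlus))
    (hvMinus : vMinus = bMinus ^ 2 + PMinus * (gPlus - gMinus) ^ 2 -
      2 * bMinus * PMinus * (gPlus - gMinus)) :
    piStar * vPlus + (1 - piStar) * vMinus =
      4 * δ ^ 2 * ((1 - p' + piStar * (p' - p)) / (p + p' - 2) ^ 2 -
        piStar * (1 - piStar)) := by
  have hS : 2 - p - p' ≠ 0 := by
    have h₁ := hp.2
    have h₂ := hp'.2
    exact ne_of_gt (by linarith)
  have hT : p + p' - 2 = -(2 - p - p') := by ring
  subst hvPlus hvMinus hbPlus hbMinus hgPlus hgMinus hPPlus hPMinus hs hpi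
  rw [hT]
  field_simp
  ring
end

section
/- Let m(i,j) > 0, for i,j ∈ {−1,1}, be real numbers with M(i) := m(i,1) + m(i,−1) < 1 for i = ±1, let Δ := m(1,1)m(−1,−1) − m(−1,1)m(1,−1), λ := (1+Δ − √((1+Δ)² − 4m(1,1)m(−1,−1)))/(2m(1,1)), a₁ := m(1,−1)/(1 − λ m(1,1)) and b₁ := (m(−1,1)a₁ + Δ)/m(1,1). Then for every n ≥ 1, the numbers a_n := a₁λ^{n−1} and b_n := b₁λ^{n−1}, together with a₀ = b₀ = 1, satisfy the coupled system a_{n+1} = m(1,1)a_{n+2} + m(1,−1)b_n and b_{n+1} = m(−1,1)a_{n+2} + m(−1,−1)b_n for all n ≥ 0, and moreover 0 < a_n ≤ 1 and 0 < b_n ≤ 1 for all n ≥ 0. -/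
/-- If `p X² - B X + s` is negative at `1`, with `p, s > 0`, its smaller root lies in `(0, 1)`. -/
theorem quadratic_smaller_root_mem_unit_interval {p s B x : ℝ} (hp : 0 < p) (hs : 0 < s)
    (hB : p + s < B) (hx : x = (B - Real.sqrt (B ^ 2 - 4 * p * s)) / (2 * p)) :
    0 < x ∧ x < 1 ∧ p * x ^ 2 - B * x + s = 0 := by
  have hps : 0 < p * s := mul_pos hp hs
  have hD : 0 ≤ B ^ 2 - 4 * p * s := by nlinarith [sq_nonneg (p - s)]
  have hsq := Real.sq_sqrt hD
  have hlt : Real.sqrt (B ^ 2 - 4 * p * s) < B := by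
    rw [Real.sqrt_lt' (by linarith)]
    linarith
  have hgt : B - 2 * p < Real.sqrt (B ^ 2 - 4 * p * s) := by
    apply Real.lt_sqrt_of_sq_lt
    nlinarith [mul_pos hp (sub_pos.mpr hB)]
  refine ⟨?_, ?_, ?_⟩
  · rw [hx]
    exact div_pos (by linarith) (by linarith)
  · rw [hx, div_lt_one (by linarith)]
    linarith
  · have hroot : Real.sqrt (B ^ 2 - 4 * p * s) = B - 2 * p * x := by
      rw [hx]
      field_simp
      ring
    rw [hroot] at hsq
    have h : p * (p * x ^ 2 - B * x + s) = 0 := by linarith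
    exact (mul_eq_zero.mp h).resolve_left hp.ne'

/-- Verification half of the closed-form solution: with `M(i) < 1`, `Δ` and the smaller
root `λ` of `m(1,1)X² - (1+Δ)X + m(-1,-1)`, the geometric sequences `a_n = a₁λ^{n-1}`,
`b_n = b₁λ^{n-1}` (with `a_0 = b_0 = 1`, `a₁ = m(1,-1)/(1-λm(1,1))`,
`b₁ = (m(-1,1)a₁+Δ)/m(1,1)`) solve the coupled recurrence system and lie in `(0,1]`. -/
theorem geometric_sequences_solve_system
    (m : ℤ → ℤ → ℝ)
    (hpos : ∀ i ∈ ({-1, 1} : Set ℤ), ∀ j ∈ ({-1, 1} : Set ℤ), 0 < m i j)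
    (hM1 : m 1 1 + m 1 (-1) < 1) (hM2 : m (-1) 1 + m (-1) (-1) < 1)
    (Δ : ℝ) (hΔ : Δ = m 1 1 * m (-1) (-1) - m (-1) 1 * m 1 (-1))
    (lam : ℝ)
    (hlam : lam =
      (1 + Δ - Real.sqrt ((1 + Δ) ^ 2 - 4 * m 1 1 * m (-1) (-1))) / (2 * m 1 1))
    (a₁ b₁ : ℝ)
    (ha₁ : a₁ = m 1 (-1) / (1 - lam * m 1 1))
    (hb₁ : b₁ = (m (-1) 1 * a₁ + Δ) / m 1 1)
    (a b : ℕ → ℝ)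
    (ha0 : a 0 = 1) (hb0 : b 0 = 1)
    (ha : ∀ n : ℕ, 1 ≤ n → a n = a₁ * lam ^ (n - 1))
    (hb : ∀ n : ℕ, 1 ≤ n → b n = b₁ * lam ^ (n - 1)) :
    (∀ n : ℕ, a (n + 1) = m 1 1 * a (n + 2) + m 1 (-1) * b n ∧
      b (n + 1) = m (-1) 1 * a (n + 2) + m (-1) (-1) * b n) ∧
    (∀ n : ℕ, 0 < a n ∧ a n ≤ 1 ∧ 0 < b n ∧ b n ≤ 1) := by
  have hp : 0 < m 1 1 := hpos 1 (by simp) 1 (by simp)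
  have hq : 0 < m 1 (-1) := hpos 1 (by simp) (-1) (by simp)
  have hr : 0 < m (-1) 1 := hpos (-1) (by simp) 1 (by simp)
  have hs : 0 < m (-1) (-1) := hpos (-1) (by simp) (-1) (by simp)
  generalize m 1 1 = p at *
  generalize m 1 (-1) = q at *
  generalize m (-1) 1 = r at *
  generalize m (-1) (-1) = s at *
  have hB : p + s < 1 + Δ := by
    have h : r * q < (1 - s) * (1 - p) :=
      mul_lt_mul'' (by linarith) (by linarith) hr.le hq.le
    linarith
  obtain ⟨hl0, hl1, hroot⟩ := quadratic_smaller_root_mem_unit_interval hp hs hB hlam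
  have hlp : lam * p < p := mul_lt_of_lt_one_left hp hl1
  have hden : 0 < 1 - lam * p := by linarith
  have ha₁_mul : a₁ * (1 - lam * p) = q := by
    rw [ha₁]
    exact div_mul_cancel₀ _ hden.ne'
  have ha₁_pos : 0 < a₁ := by
    rw [ha₁]
    exact div_pos hq hden
  have ha₁_le : a₁ ≤ 1 := by
    rw [ha₁, div_le_one hden]
    linarith
  have hb₁_rec : b₁ = r * a₁ * lam + s := by
    rw [hb₁, div_eq_iff hp.ne']
    linear_combination hΔ + r * ha₁_mul
  have hb₁_eq : b₁ = lam := by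
    apply mul_right_cancel₀ hden.ne'
    linear_combination (1 - lam * p) * hb₁_rec + r * lam * ha₁_mul + hroot + lam * hΔ
  have ha' (n : ℕ) : a (n + 1) = a₁ * lam ^ n := ha (n + 1) (by omega)
  have hb' (n : ℕ) : b (n + 1) = b₁ * lam ^ n := hb (n + 1) (by omega)
  have hb_pow (n : ℕ) : b n = lam ^ n := by
    cases n with
    | zero => simpa using hb0
    | succ n => rw [hb', hb₁_eq, pow_succ']
  refine ⟨fun n => ?_, fun n => ?_⟩
  · rw [ha' n, ha' (n + 1), hb_pow n, hb_pow (n + 1), pow_succ]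
    rw [hb₁_eq] at hb₁_rec
    constructor
    · linear_combination lam ^ n * ha₁_mul
    · linear_combination lam ^ n * hb₁_rec
  · rw [hb_pow n]
    refine and_assoc.mp ⟨?_, pow_pos hl0 n, pow_le_one₀ hl0.le hl1.le⟩
    cases n with
    | zero => simp [ha0]
    | succ n =>
      rw [ha']
      exact ⟨mul_pos ha₁_pos (pow_pos hl0 n),
        mul_le_one₀ ha₁_le (pow_pos hl0 n).le (pow_le_one₀ hl0.le hl1.le)⟩
end
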